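/- Regularity is stable under orthogonality: if A is a regular behaviour then A⊥ is regular. -/

import Mathlib

namespace Ludics

abbrev Address := List ℕ

/-- An action of Ludics: the daimon, or a proper action given by a polarity
(`true` = positive), a focus address and a ramification. -/
inductive Action where
  | daimon : Action
  | proper (pos : Bool) (focus : Address) (ram : Finset ℕ) : Action
deriving DecidableEq

namespace Action

def isPositive : Action → Bool
  | daimon => true
  | proper pos _ _ => pos

def focus? : Action → Option Address
  | daimon => none
  | proper _ ξ _ => some ξ

/-- Reverse the polarity of an action. -/
def dual : Action → Action
  | daimon => daimon
  | proper pos ξ I => proper (!pos) ξ I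

/-- `a.justifiesB b` : the focus of `b` is one of the addresses created by `a`. -/
def justifiesB : Action → Action → Bool
  | proper _ ξ I, proper _ ζ _ => decide (∃ i ∈ I, ζ = ξ ++ [i])
  | _, _ => false

def justifies (a b : Action) : Prop := a.justifiesB b = true

end Action

/-- A sequent of a base: an optional left address (at most one) and a finite
set of right addresses. -/
structure Sequent where
  left : Option Address
  right : Finset Address

abbrev Base := List Sequent

def Base.isPositive (β : Base) : Prop := ∃ σ ∈ β, σ.left = none

/-- An action is initial w.r.t. a base if its focus belongs to the base
(on the side corresponding to its polarity). -/
def Initial (β : Base) (a : Action) : Prop :=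
  ∃ pol ξ I, a = .proper pol ξ I ∧
    ∃ σ ∈ β, (pol = true ∧ ξ ∈ σ.right) ∨ (pol = false ∧ σ.left = some ξ)

/-- A sequent "owns" an action when its focus is hereditarily justified by an
address of the sequent (i.e. extends an address of the sequent). -/
def Sequent.owns (σ : Sequent) (a : Action) : Prop :=
  ∃ ξ, a.focus? = some ξ ∧
    ((∃ γ, σ.left = some γ ∧ γ <+: ξ) ∨ (∃ δ ∈ σ.right, δ <+: ξ))

def Sequent.addresses (σ : Sequent) : Set Address :=
  (match σ.left with | some γ => {γ} | none => ∅) ∪ ↑σ.right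

def Base.addresses (β : Base) : Set Address :=
  {a | ∃ σ ∈ β, a ∈ σ.addresses}

/-- The dual base: each sequent `Γ ⊢ Δ` gives sequents `⊢ Γ` and `δ ⊢` for δ ∈ Δ. -/
noncomputable def Sequent.dualSequents (σ : Sequent) : List Sequent :=
  (match σ.left with
    | some γ => [⟨none, ({γ} : Finset Address)⟩]
    | none => []) ++
    σ.right.toList.map fun δ => ⟨some δ, (∅ : Finset Address)⟩

noncomputable def Base.dual (β : Base) : Base := (β.map Sequent.dualSequents).flatten

/-- View of a sequence, computed on the reversed sequence (most recent action
first), with fuel. -/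
def viewRevAux : ℕ → List Action → List Action
  | 0, _ => []
  | _ + 1, [] => []
  | n + 1, a :: w =>
    if a.isPositive then a :: viewRevAux n w
    else a :: viewRevAux n (w.dropWhile fun b => !(b.justifiesB a))

def viewRev (s : List Action) : List Action := viewRevAux s.length s

/-- The view `⌜s⌝` of a sequence of actions. -/
def view (s : List Action) : List Action := (viewRev s.reverse).reverse

/-- `p` is a path based on `β`. -/
structure IsPath (β : Base) (p : List Action) : Prop where
  alternating : p.Chain' fun a b => a.isPositive ≠ b.isPositive
  justified : ∀ w a, w ++ [a] <+: p → a ≠ Action.daimon →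
    Initial β a ∨ ∃ b ∈ w, b.justifies a
  negJump : ∀ w a b, w ++ [a] <+: p → a.isPositive = true → b ∈ w →
    b.justifies a → b ∈ view w
  posJump : ∀ w a, w ++ [a] <+: p → a.isPositive = true → a ≠ Action.daimon →
    ∀ σ ∈ β, (∃ f, a.focus? = some f ∧ f ∈ σ.right) →
      (w = [] ∧ σ.left = none) ∨
      ∃ w' b, w = w' ++ [b] ∧ b.isPositive = false ∧ σ.owns b
  linearity : (p.filterMap Action.focus?).Nodup
  daimonLast : ∀ w, w ++ [Action.daimon] <+: p → w ++ [Action.daimon] = p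
  daimonFirst : p.head? = some Action.daimon → β.isPositive
  totality : β.isPositive → ∃ a t, p = a :: t ∧
    (a = Action.daimon ∨ (a.isPositive = true ∧ Initial β a))

/-- A chronicle: a non-empty path where each non-initial negative action is
justified by the immediately preceding action. -/
def IsChronicle (β : Base) (c : List Action) : Prop :=
  IsPath β c ∧ c ≠ [] ∧
    ∀ w a b, w ++ [a, b] <+: c → b.isPositive = false →
      Initial β b ∨ a.justifies b

/-- The dual of a positive-ended sequence: reverse all polarities, removing a
final daimon if present and appending one otherwise. -/
def dualSeq (p : List Action) : List Action :=
  if p.getLast? = some Action.daimon then p.dropLast.map Action.dual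
  else p.map Action.dual ++ [Action.daimon]

/-- Positive-ended (possibly empty) sequence. -/
def PosEnded (p : List Action) : Prop :=
  p = [] ∨ ∃ a, p.getLast? = some a ∧ a.isPositive = true

/-- A (non-empty) negative-starting, positive-ended block. -/
def NegBlock (b : List Action) : Prop :=
  b ≠ [] ∧ (∀ a, b.head? = some a → a.isPositive = false) ∧
    ∀ a, b.getLast? = some a → a.isPositive = true

def EndsWithDaimon (p : List Action) : Prop := p.getLast? = some Action.daimon

/-- Basic shuffle of two positive-ended negative paths: interleaving by
positive-ended negative blocks; if the last `p`-block ends with the daimon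
then the last `q`-block is empty. -/
def ShuffleNeg (p q r : List Action) : Prop :=
  ∃ ps qs : List (List Action),
    ps.length = qs.length ∧
    (∀ b ∈ ps, b = [] ∨ NegBlock b) ∧
    (∀ b ∈ qs, b = [] ∨ NegBlock b) ∧
    ps.flatten = p ∧ qs.flatten = q ∧
    (List.zipWith (· ++ ·) ps qs).flatten = r ∧
    (EndsWithDaimon (ps.getLast?.getD []) → qs.getLast?.getD [] = [])

/-- The shuffle `r ∈ p ⧢ q`, including the extensions to two daimon-ended
paths and to paths with a common positive-ended prefix. -/
inductive Shuffle : List Action → List Action → List Action → Prop where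
  | base {p q r} : ShuffleNeg p q r → Shuffle p q r
  | daiLeft {p q r} {κ₁ κ₂ : Action} :
      Shuffle (p ++ [κ₁, Action.daimon]) q r →
      Shuffle (p ++ [κ₁, Action.daimon]) (q ++ [κ₂, Action.daimon]) r
  | daiRight {p q r} {κ₁ κ₂ : Action} :
      Shuffle p (q ++ [κ₂, Action.daimon]) r →
      Shuffle (p ++ [κ₁, Action.daimon]) (q ++ [κ₂, Action.daimon]) r
  | pre {s p q r} : s ≠ [] → PosEnded s → Shuffle p q r →
      Shuffle (s ++ p) (s ++ q) (s ++ r)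

/-- Shuffle closure of a set of (positive-ended) paths. -/
inductive ShuffleClosure (P : Set (List Action)) : List Action → Prop where
  | mem {p} : p ∈ P → ShuffleClosure P p
  | shuffle {p q r} : ShuffleClosure P p → ShuffleClosure P q →
      Shuffle p q r → ShuffleClosure P r

/-- Coherence of chronicles: comparability and propagation. -/
def Coherent (c₁ c₂ : List Action) : Prop :=
  (∀ w κ₁ κ₂, w ++ [κ₁] <+: c₁ → w ++ [κ₂] <+: c₂ →
      κ₁ = κ₂ ∨ (κ₁.isPositive = false ∧ κ₂.isPositive = false)) ∧
  (∀ w ξ₁ I₁ w₁ σ₁ ξ₂ I₂ w₂ σ₂,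
      w ++ Action.proper false ξ₁ I₁ :: w₁ ++ [σ₁] <+: c₁ →
      w ++ Action.proper false ξ₂ I₂ :: w₂ ++ [σ₂] <+: c₂ →
      ξ₁ ≠ ξ₂ → ∀ f, σ₁.focus? = some f → σ₂.focus? ≠ some f)

/-- A design, as a prefix-closed clique of chronicles. -/
structure IsDesign (β : Base) (D : Set (List Action)) : Prop where
  chron : ∀ c ∈ D, IsChronicle β c
  prefixClosed : ∀ c ∈ D, ∀ d, d <+: c → d ≠ [] → d ∈ D
  coherent : ∀ c ∈ D, ∀ d ∈ D, Coherent c d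
  maxPos : ∀ c ∈ D, (∀ κ, c ++ [κ] ∉ D) →
    ∃ a, c.getLast? = some a ∧ a.isPositive = true
  posNonempty : β.isPositive → D.Nonempty

/-- A net of designs, abusively seen as its set of chronicles. -/
structure IsNet (β : Base) (R : Set (List Action)) : Prop where
  chron : ∀ c ∈ R, IsChronicle β c
  prefixClosed : ∀ c ∈ R, ∀ d, d <+: c → d ≠ [] → d ∈ R

/-- `p` is a path of the design/net `D`: each view of each non-empty prefix of
`p` is a chronicle of `D`. -/
def PathOf (β : Base) (D : Set (List Action)) (p : List Action) : Prop :=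
  IsPath β p ∧ ∀ q, q <+: p → q ≠ [] → view q ∈ D

/-- Whose turn it is in normalization: `dpos` says whether the design `D` owns
the first (positive) move; afterwards `D` moves exactly after negative actions. -/
def TurnD (dpos : Prop) (s : List Action) : Prop :=
  match s.getLast? with
  | none => dpos
  | some a => a.isPositive = false

/-- Interaction (normalization) between a design `D` and a counter-net `R`,
described by its visited sequence `s` (seen from `D`): it converges from
state `s` if the design to move plays the daimon, or it plays a proper
positive action accepted (in dual form) by the other one, and the interaction
converges from the extended state. -/
inductive Conv (D R : Set (List Action)) (dpos : Prop) : List Action → Prop where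
  | daiD {s} : TurnD dpos s → view (s ++ [Action.daimon]) ∈ D → Conv D R dpos s
  | daiR {s} : ¬ TurnD dpos s →
      view (s.map Action.dual ++ [Action.daimon]) ∈ R → Conv D R dpos s
  | stepD {s κ} : TurnD dpos s → κ.isPositive = true → κ ≠ Action.daimon →
      view (s ++ [κ]) ∈ D → view ((s ++ [κ]).map Action.dual) ∈ R →
      Conv D R dpos (s ++ [κ]) → Conv D R dpos s
  | stepR {s κ} : ¬ TurnD dpos s → κ.isPositive = false →
      view ((s ++ [κ]).map Action.dual) ∈ R → view (s ++ [κ]) ∈ D →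
      Conv D R dpos (s ++ [κ]) → Conv D R dpos s

/-- The simple base `⊢ ξ` (positive) or `ξ ⊢` (negative). -/
def simpleBase (ξ : Address) (pos : Bool) : Base :=
  if pos then [⟨none, {ξ}⟩] else [⟨some ξ, ∅⟩]

/-- The orthogonal of a set of designs on a simple base. -/
def orthSet (ξ : Address) (pos : Bool) (A : Set (Set (List Action))) :
    Set (Set (List Action)) :=
  {E | IsDesign (simpleBase ξ !pos) E ∧
    ∀ D ∈ A, if pos then Conv D E True [] else Conv E D True []}

def biorth (ξ : Address) (pos : Bool) (A : Set (Set (List Action))) :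
    Set (Set (List Action)) :=
  orthSet ξ (!pos) (orthSet ξ pos A)

/-- A behaviour: a bi-orthogonally closed set of designs on a simple base. -/
structure Behaviour (ξ : Address) (pos : Bool) where
  designs : Set (Set (List Action))
  isDesign : ∀ D ∈ designs, IsDesign (simpleBase ξ pos) D
  closed : designs = biorth ξ pos designs

/-- Visitable paths of a set of designs: traces of convergent normalizations
with the orthogonal, characterized as the dual pairs of paths. -/
def VisitableSet (ξ : Address) (pos : Bool) (S : Set (Set (List Action)))
    (p : List Action) : Prop :=
  ∃ D ∈ S, ∃ E ∈ orthSet ξ pos S,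
    PathOf (simpleBase ξ pos) D p ∧ PathOf (simpleBase ξ !pos) E (dualSeq p)

def Visitable {ξ : Address} {pos : Bool} (A : Behaviour ξ pos)
    (p : List Action) : Prop :=
  VisitableSet ξ pos A.designs p

/-- Material (incarnated) design of a behaviour: inclusion-minimal. -/
def Material {ξ : Address} {pos : Bool} (A : Behaviour ξ pos)
    (D : Set (List Action)) : Prop :=
  D ∈ A.designs ∧ ∀ E ∈ A.designs, E ⊆ D → E = D

/-- Completion of a design: add daimon-ended chronicles after every missing
negative action. -/
def completion (β : Base) (D : Set (List Action)) : Set (List Action) :=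
  D ∪ {c' | ∃ c ∈ D, ∃ ξ I,
    (c' = c ++ [Action.proper false ξ I] ∨
      c' = c ++ [Action.proper false ξ I, Action.daimon]) ∧
    IsChronicle β (c ++ [Action.proper false ξ I, Action.daimon]) ∧
    c ++ [Action.proper false ξ I] ∉ D}

def DaiDesign : Set (List Action) := {[Action.daimon]}

def firstAction (D : Set (List Action)) (κ : Action) : Prop :=
  ∃ c ∈ D, c.head? = some κ

/-- Directory of a set of positive designs on `⊢ ξ`. -/
def directory (ξ : Address) (A : Set (Set (List Action))) : Set (Finset ℕ) :=
  {I | ∃ D ∈ A, firstAction D (Action.proper true ξ I)}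

/-- Alien positive behaviours: ramifications of first actions pairwise disjoint. -/
def Alien (ξ : Address) (A B : Behaviour ξ true) : Prop :=
  ∀ I ∈ directory ξ A.designs, ∀ J ∈ directory ξ B.designs, Disjoint I J

/-- Extension of the first action of a design by a set `J`. -/
def extDesign (ξ : Address) (J : Finset ℕ) (D : Set (List Action)) :
    Set (List Action) :=
  {c | ∃ I t, (Action.proper true ξ I :: t) ∈ D ∧
      c = Action.proper true ξ (I ∪ J) :: t}

/-- The extension `A_[B]` of a set of designs along another. -/
def extended (ξ : Address) (A B : Set (Set (List Action))) :
    Set (Set (List Action)) :=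
  insert DaiDesign
    {D' | ∃ D ∈ A, (∃ I, firstAction D (Action.proper true ξ I)) ∧
      ∃ E ∈ B, ∃ J, firstAction E (Action.proper true ξ J) ∧
        D' = extDesign ξ J D}

/-- The extension `P_[Q]` of a set of paths along another. -/
def extPaths (ξ : Address) (P Q : Set (List Action)) : Set (List Action) :=
  insert [Action.daimon]
    {p | ∃ I t, (Action.proper true ξ I :: t) ∈ P ∧
      ∃ q ∈ Q, ∃ J, q.head? = some (Action.proper true ξ J) ∧
        p = Action.proper true ξ (I ∪ J) :: t}

/-- Prefixing a (negative) design by the positive action `(+, ξ, {i})`. -/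
def shiftD (ξ : Address) (i : ℕ) (D : Set (List Action)) : Set (List Action) :=
  insert [Action.proper true ξ {i}]
    {c | ∃ d ∈ D, c = Action.proper true ξ {i} :: d}

/-- `C = ↑N` : the positive shift of the negative behaviour `N`. -/
def IsShiftOf (ξ : Address) (i : ℕ) (C : Behaviour ξ true)
    (N : Behaviour (ξ ++ [i]) false) : Prop :=
  C.designs = biorth ξ true (shiftD ξ i '' N.designs)

/-- `C = ⊕ₖ F k`. -/
def IsSumOf {ξ : Address} {ι : Type} (C : Behaviour ξ true)
    (F : ι → Behaviour ξ true) : Prop :=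
  C.designs = biorth ξ true (⋃ k, (F k).designs)

/-- Pairwise disjoint family of positive behaviours (disjoint directories). -/
def PairwiseDisjointFam {ξ : Address} {ι : Type}
    (F : ι → Behaviour ξ true) : Prop :=
  ∀ k l, k ≠ l → ∀ I ∈ directory ξ (F k).designs,
    I ∉ directory ξ (F l).designs

open Classical in
/-- Tensor of two positive designs on `⊢ ξ`. -/
noncomputable def tensorD (ξ : Address) (D E : Set (List Action)) :
    Set (List Action) :=
  if D = DaiDesign ∨ E = DaiDesign then DaiDesign
  else {c | ∃ I J, firstAction D (Action.proper true ξ I) ∧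
      firstAction E (Action.proper true ξ J) ∧
      ∃ t, ((Action.proper true ξ I :: t) ∈ D ∨
            (Action.proper true ξ J :: t) ∈ E) ∧
        c = Action.proper true ξ (I ∪ J) :: t}

/-- `C = A ⊗ B`. -/
def IsTensorOf {ξ : Address} (C A B : Behaviour ξ true) : Prop :=
  C.designs = biorth ξ true
    {G | ∃ D ∈ A.designs, ∃ E ∈ B.designs, G = tensorD ξ D E}

/-- Hereditary chains of justifiers inside a sequence `p`. -/
inductive JustChain (β : Base) (p : List Action) : List Action → Prop where
  | init {κ} : κ ∈ p → Initial β κ → JustChain β p [κ]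
  | cons {s κ κ'} : JustChain β p (s ++ [κ]) → κ' ∈ p → κ.justifies κ' →
      JustChain β p (s ++ [κ, κ'])

/-- Trivial chronicle for a behaviour: hereditary-justifier sequence of an
action of a chronicle of a material design. -/
def TrivialChronicle {ξ : Address} {pos : Bool} (A : Behaviour ξ pos)
    (s : List Action) : Prop :=
  ∃ D, Material A D ∧ ∃ c ∈ D, JustChain (simpleBase ξ pos) c s

/-- Regular path for a behaviour: reversible path whose justifier chains are
trivial chronicles for the behaviour. -/
def RegularPath {ξ : Address} {pos : Bool} (A : Behaviour ξ pos)
    (p : List Action) : Prop :=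
  IsPath (simpleBase ξ pos) p ∧ IsPath (simpleBase ξ !pos) (dualSeq p) ∧
  ∀ κ ∈ p, κ ≠ Action.daimon →
    ∃ s, JustChain (simpleBase ξ pos) p s ∧ s.getLast? = some κ ∧
      TrivialChronicle A s

/-- Regular behaviour: every regular path is visitable. -/
def Regular {ξ : Address} {pos : Bool} (A : Behaviour ξ pos) : Prop :=
  ∀ p, RegularPath A p → Visitable A p

/-- Proper actions occurring in a design. -/
def properActs (D : Set (List Action)) : Set Action :=
  {a | a ≠ Action.daimon ∧ ∃ c ∈ D, a ∈ c}

/-- Essentially finite behaviour: finitely many material designs, all finite. -/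
def EssFinite {ξ : Address} {pos : Bool} (A : Behaviour ξ pos) : Prop :=
  {D | Material A D}.Finite ∧ ∀ D, Material A D → (properActs D).Finite

/-- A slice of a design. -/
def IsSlice (D S : Set (List Action)) : Prop :=
  S ⊆ D ∧ (∀ c ∈ S, ∀ d, d <+: c → d ≠ [] → d ∈ S) ∧
  ∀ w ξ I₁ I₂, w ++ [Action.proper false ξ I₁] ∈ S →
    w ++ [Action.proper false ξ I₂] ∈ S → I₁ = I₂

/-- Uniformly bounded behaviour: slice sizes of material designs uniformly
bounded. -/
def UnifBounded {ξ : Address} {pos : Bool} (A : Behaviour ξ pos) : Prop :=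
  ∃ N : ℕ, ∀ D, Material A D → ∀ S, IsSlice D S →
    (properActs S).Finite ∧ (properActs S).ncard < N

def oneDesign (ξ : Address) : Set (List Action) :=
  {[Action.proper true ξ ∅]}

mutual
  /-- The class `C∞⁺` of positive behaviours: `0`, `1`, or a (possibly
  infinite) nonempty sum of finite tensors of shifts of `C∞⁻` elements. -/
  inductive CInf : (ξ : Address) → Behaviour ξ true → Prop where
    | zero {ξ} (A : Behaviour ξ true) :
        A.designs = {DaiDesign} → CInf ξ A
    | one {ξ} (A : Behaviour ξ true) :
        A.designs = biorth ξ true {oneDesign ξ} → CInf ξ A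
    | sum {ξ} {ι : Type} (F : ι → Behaviour ξ true) (C : Behaviour ξ true) :
        Nonempty ι → (∀ k, CInfTS ξ (F k)) → PairwiseDisjointFam F →
        IsSumOf C F → CInf ξ C
  /-- Finite tensors of positive shifts of duals of `C∞⁺` elements. -/
  inductive CInfTS : (ξ : Address) → Behaviour ξ true → Prop where
    | shift {ξ} {i : ℕ} (C : Behaviour ξ true) (N : Behaviour (ξ ++ [i]) false)
        (P : Behaviour (ξ ++ [i]) true) :
        CInf (ξ ++ [i]) P → N.designs = orthSet (ξ ++ [i]) true P.designs →
        IsShiftOf ξ i C N → CInfTS ξ C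
    | tensor {ξ} (A B C : Behaviour ξ true) :
        CInfTS ξ A → CInfTS ξ B → Alien ξ A B → IsTensorOf C A B →
        CInfTS ξ C
end

mutual
  /-- The class `C_f⁺`: as `C∞⁺` but with finite sums only. -/
  inductive CFin : (ξ : Address) → Behaviour ξ true → Prop where
    | zero {ξ} (A : Behaviour ξ true) :
        A.designs = {DaiDesign} → CFin ξ A
    | one {ξ} (A : Behaviour ξ true) :
        A.designs = biorth ξ true {oneDesign ξ} → CFin ξ A
    | sum {ξ} {ι : Type} (F : ι → Behaviour ξ true) (C : Behaviour ξ true) :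
        Nonempty ι → Finite ι → (∀ k, CFinTS ξ (F k)) → PairwiseDisjointFam F →
        IsSumOf C F → CFin ξ C
  inductive CFinTS : (ξ : Address) → Behaviour ξ true → Prop where
    | shift {ξ} {i : ℕ} (C : Behaviour ξ true) (N : Behaviour (ξ ++ [i]) false)
        (P : Behaviour (ξ ++ [i]) true) :
        CFin (ξ ++ [i]) P → N.designs = orthSet (ξ ++ [i]) true P.designs →
        IsShiftOf ξ i C N → CFinTS ξ C
    | tensor {ξ} (A B C : Behaviour ξ true) :
        CFinTS ξ A → CFinTS ξ B → Alien ξ A B → IsTensorOf C A B →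
        CFinTS ξ C
end

/-- The class `C∞⁻` : duals of `C∞⁺` elements. -/
def CInfN (ξ : Address) (B : Behaviour ξ false) : Prop :=
  ∃ A : Behaviour ξ true, CInf ξ A ∧ B.designs = orthSet ξ true A.designs

def CFinN (ξ : Address) (B : Behaviour ξ false) : Prop :=
  ∃ A : Behaviour ξ true, CFin ξ A ∧ B.designs = orthSet ξ true A.designs

theorem nil_or_snoc (s : List Action) : s = [] ∨ ∃ t a, s = t ++ [a] := by
  simpa using List.eq_nil_or_concat s

theorem dual_dual (a : Action) : a.dual.dual = a := by
  cases a <;> simp [Action.dual]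

theorem map_dual_dual (s : List Action) : (s.map Action.dual).map Action.dual = s := by
  rw [List.map_map]
  conv_rhs => rw [← List.map_id s]
  apply List.map_congr_left
  intro a _
  exact dual_dual a

theorem dual_pos {a : Action} (h : a ≠ Action.daimon) :
    a.dual.isPositive = !a.isPositive := by
  cases a <;> simp_all [Action.dual, Action.isPositive]

theorem dual_ne {a : Action} (h : a ≠ Action.daimon) : a.dual ≠ Action.daimon := by
  cases a <;> simp_all [Action.dual]

theorem dual_focus (a : Action) : a.dual.focus? = a.focus? := by
  cases a <;> simp [Action.dual, Action.focus?]

theorem justifies_dual {a b : Action} (h : a.justifies b) : a.dual.justifies b.dual := by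
  cases a <;> cases b <;> simp_all [Action.justifies, Action.justifiesB, Action.dual]

theorem neg_ne_dai {a : Action} (h : a.isPositive = false) : a ≠ Action.daimon := by
  rintro rfl; simp [Action.isPositive] at h

theorem viewRevAux_fuel : ∀ n m (w : List Action), w.length ≤ n → w.length ≤ m →
    viewRevAux n w = viewRevAux m w := by
  intro n
  induction n with
  | zero =>
    intro m w h _
    have : w = [] := by simpa using h
    subst this
    cases m <;> simp [viewRevAux]
  | succ n ih =>
    intro m w h h'
    cases w with
    | nil => cases m <;> simp [viewRevAux]
    | cons a w =>
      cases m with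
      | zero => simp at h'
      | succ m =>
        simp only [List.length_cons, Nat.add_le_add_iff_right] at h h'
        have hd := List.length_dropWhile_le (fun b : Action => !(b.justifiesB a)) w
        simp only [viewRevAux]
        rw [ih m w h h', ih m _ (hd.trans h) (hd.trans h')]

theorem viewRev_cons (a : Action) (w : List Action) :
    viewRev (a :: w) = if a.isPositive then a :: viewRev w
      else a :: viewRev (w.dropWhile fun b => !(b.justifiesB a)) := by
  have hd := List.length_dropWhile_le (fun b : Action => !(b.justifiesB a)) w
  simp only [viewRev, List.length_cons, viewRevAux]
  rw [viewRevAux_fuel w.length _ _ hd le_rfl]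

theorem view_nil : view [] = [] := by simp [view, viewRev, viewRevAux]

theorem view_pos {a : Action} (s : List Action) (h : a.isPositive = true) :
    view (s ++ [a]) = view s ++ [a] := by
  simp [view, viewRev_cons, h]

theorem view_concat (s : List Action) (a : Action) :
    ∃ s', s' <+: s ∧ view (s ++ [a]) = view s' ++ [a] := by
  by_cases h : a.isPositive = true
  · exact ⟨s, List.prefix_rfl, view_pos s h⟩
  · refine ⟨(s.reverse.dropWhile fun b => !(b.justifiesB a)).reverse, ?_, ?_⟩
    · have := List.dropWhile_suffix (l := s.reverse) (fun b => !(b.justifiesB a))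
      have := List.reverse_prefix.2 this
      simpa using this
    · simp [view, viewRev_cons, h]

theorem view_ne {s : List Action} (h : s ≠ []) : view s ≠ [] := by
  obtain ⟨t, a, rfl⟩ := nil_or_snoc s |>.resolve_left h
  obtain ⟨s', _, e⟩ := view_concat t a
  simp [e]

theorem view_prefix : ∀ n (s d : List Action), s.length ≤ n → d <+: view s →
    ∃ t, t <+: s ∧ d = view t := by
  intro n
  induction n with
  | zero =>
    intro s d h hd
    have : s = [] := by simpa using h
    subst this
    rw [view_nil] at hd
    exact ⟨[], List.prefix_rfl, by rw [view_nil]; simpa using hd⟩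
  | succ n ih =>
    intro s d h hd
    rcases nil_or_snoc s with rfl | ⟨t, a, rfl⟩
    · rw [view_nil] at hd
      exact ⟨[], List.prefix_rfl, by rw [view_nil]; simpa using hd⟩
    · obtain ⟨s', hs', e⟩ := view_concat t a
      have hd' := hd
      rw [e, List.prefix_concat_iff] at hd
      rcases hd with rfl | hd
      · exact ⟨_, List.prefix_rfl, e.symm⟩
      · have hl := hs'.length_le
        simp at h
        obtain ⟨t', ht', rfl⟩ := ih s' d (by omega) hd
        exact ⟨t', (ht'.trans hs').trans (List.prefix_append _ _), rfl⟩

theorem view_subset : ∀ n (s : List Action), s.length ≤ n → ∀ a ∈ view s, a ∈ s := by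
  intro n
  induction n with
  | zero =>
    intro s h
    have : s = [] := by simpa using h
    subst this
    simp [view_nil]
  | succ n ih =>
    intro s h
    rcases nil_or_snoc s with rfl | ⟨t, a, rfl⟩
    · simp [view_nil]
    · obtain ⟨s', hs', e⟩ := view_concat t a
      intro b hb
      rw [e] at hb
      have hl := hs'.length_le
      simp at h
      rcases List.mem_append.1 hb with hb | hb
      · exact List.mem_append_left _ (hs'.subset (ih s' (by omega) b hb))
      · exact List.mem_append_right _ hb

theorem mem_of_view {s : List Action} {a : Action} (h : a ∈ view s) : a ∈ s :=
  view_subset _ s le_rfl a h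

inductive Reach (D R : Set (List Action)) (dpos : Prop) : List Action → Prop where
  | nil : Reach D R dpos []
  | stepD {s κ} : Reach D R dpos s → TurnD dpos s → κ.isPositive = true →
      κ ≠ Action.daimon → view (s ++ [κ]) ∈ D → view ((s ++ [κ]).map Action.dual) ∈ R →
      Reach D R dpos (s ++ [κ])
  | stepR {s κ} : Reach D R dpos s → ¬ TurnD dpos s → κ.isPositive = false →
      view ((s ++ [κ]).map Action.dual) ∈ R → view (s ++ [κ]) ∈ D →
      Reach D R dpos (s ++ [κ])

theorem Reach.ne {D R : Set (List Action)} {dpos : Prop} {s : List Action}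
    (h : Reach D R dpos s) : ∀ a ∈ s, a ≠ Action.daimon := by
  induction h with
  | nil => simp
  | stepD _ _ _ hk _ _ ih =>
    intro a ha
    rcases List.mem_append.1 ha with ha | ha
    · exact ih a ha
    · rw [List.mem_singleton.1 ha]; exact hk
  | stepR _ _ hk _ _ ih =>
    intro a ha
    rcases List.mem_append.1 ha with ha | ha
    · exact ih a ha
    · rw [List.mem_singleton.1 ha]; exact neg_ne_dai hk

theorem turn_dual {dpos : Prop} {s : List Action} (h : ∀ a ∈ s, a ≠ Action.daimon) :
    TurnD (¬ dpos) (s.map Action.dual) ↔ ¬ TurnD dpos s := by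
  rcases nil_or_snoc s with rfl | ⟨t, a, rfl⟩
  · simp [TurnD]
  · have := dual_pos (h a (by simp))
    simp [TurnD, this]

theorem Conv.dual {D R : Set (List Action)} {dpos : Prop} {s : List Action}
    (h : Conv D R dpos s) (hs : ∀ a ∈ s, a ≠ Action.daimon) :
    Conv R D (¬ dpos) (s.map Action.dual) := by
  induction h with
  | daiD ht hv =>
    refine Conv.daiR ?_ ?_
    · rw [turn_dual hs]; simpa using ht
    · rwa [map_dual_dual]
  | daiR ht hv =>
    exact Conv.daiD ((turn_dual hs).2 ht) hv
  | @stepD s κ ht hp hk hd hr _ ih =>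
    have hs' : ∀ a ∈ s ++ [κ], a ≠ Action.daimon := by
      intro a ha
      rcases List.mem_append.1 ha with ha | ha
      · exact hs a ha
      · rw [List.mem_singleton.1 ha]; exact hk
    have ih := ih hs'
    rw [List.map_append] at ih hr
    refine Conv.stepR (κ := κ.dual) ?_ ?_ ?_ hr ih
    · rw [turn_dual hs]; simpa using ht
    · simp [dual_pos hk, hp]
    · rw [List.map_append, map_dual_dual]; simpa [dual_dual] using hd
  | @stepR s κ ht hp hr hd _ ih =>
    have hk := neg_ne_dai hp
    have hs' : ∀ a ∈ s ++ [κ], a ≠ Action.daimon := by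
      intro a ha
      rcases List.mem_append.1 ha with ha | ha
      · exact hs a ha
      · rw [List.mem_singleton.1 ha]; exact hk
    have ih := ih hs'
    rw [List.map_append] at ih hr
    refine Conv.stepD (κ := κ.dual) ?_ ?_ (dual_ne hk) hr ?_ ih
    · exact (turn_dual hs).2 ht
    · simp [dual_pos hk, hp]
    · rw [List.map_append, map_dual_dual]; simpa [dual_dual] using hd

theorem Reach.dual {D R : Set (List Action)} {dpos : Prop} {s : List Action}
    (h : Reach D R dpos s) : Reach R D (¬ dpos) (s.map Action.dual) := by
  induction h with
  | nil => exact Reach.nil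
  | @stepD s κ h0 ht hp hk hd hr ih =>
    have hs := h0.ne
    rw [List.map_append] at hr ⊢
    refine Reach.stepR (κ := κ.dual) ih ?_ ?_ ?_ hr
    · rw [turn_dual hs]; simpa using ht
    · simp [dual_pos hk, hp]
    · rw [List.map_append, map_dual_dual]; simpa [dual_dual] using hd
  | @stepR s κ h0 ht hp hr hd ih =>
    have hk := neg_ne_dai hp
    have hs := h0.ne
    rw [List.map_append] at hr ⊢
    refine Reach.stepD (κ := κ.dual) ih ?_ ?_ (dual_ne hk) hr ?_
    · exact (turn_dual hs).2 ht
    · simp [dual_pos hk, hp]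
    · rw [List.map_append, map_dual_dual]; simpa [dual_dual] using hd

theorem Reach.pre {D R : Set (List Action)} {dpos : Prop} {s : List Action}
    (h : Reach D R dpos s) : ∀ t, t <+: s → Reach D R dpos t := by
  induction h with
  | nil => intro t ht; rw [List.prefix_nil.1 ht]; exact Reach.nil
  | stepD h0 ht hp hk hd hr ih =>
    intro t h
    rcases List.prefix_concat_iff.1 h with rfl | h
    · exact Reach.stepD h0 ht hp hk hd hr
    · exact ih t h
  | stepR h0 ht hp hr hd ih =>
    intro t h
    rcases List.prefix_concat_iff.1 h with rfl | h
    · exact Reach.stepR h0 ht hp hr hd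
    · exact ih t h

theorem Reach.memD {D R : Set (List Action)} {dpos : Prop} {s : List Action}
    (h : Reach D R dpos s) (hs : s ≠ []) : view s ∈ D := by
  cases h with
  | nil => exact absurd rfl hs
  | stepD _ _ _ _ hd _ => exact hd
  | stepR _ _ _ _ hd => exact hd

/-- Coherence: positive extension is unique. -/
theorem pos_unique {β : Base} {D : Set (List Action)} (hD : IsDesign β D)
    {s : List Action} {a b : Action} (ha : a.isPositive = true)
    (hb : b.isPositive = true) (h1 : view (s ++ [a]) ∈ D) (h2 : view (s ++ [b]) ∈ D) :
    a = b := by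
  rw [view_pos _ ha] at h1
  rw [view_pos _ hb] at h2
  rcases (hD.coherent _ h1 _ h2).1 (view s) a b List.prefix_rfl List.prefix_rfl with h | h
  · exact h
  · simp [ha] at h

theorem dual_inj {a b : Action} (h : a.dual = b.dual) : a = b := by
  rw [← dual_dual a, h, dual_dual]

theorem Conv.reach {β β' : Base} {D R : Set (List Action)} {dpos : Prop}
    (hD : IsDesign β D) (hR : IsDesign β' R)
    (hc : Conv D R dpos []) {s : List Action} (h : Reach D R dpos s) :
    Conv D R dpos s := by
  induction h with
  | nil => exact hc
  | @stepD s κ h0 ht hp hk hd hr ih =>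
    cases ih with
    | daiD _ hv => exact absurd (pos_unique hD hp rfl hd hv) hk
    | daiR h _ => exact absurd ht h
    | stepD _ hp' hk' hd' _ hc' =>
      rwa [pos_unique hD hp hp' hd hd']
    | stepR h => exact absurd ht h
  | @stepR s κ h0 ht hp hr hd ih =>
    have hk := neg_ne_dai hp
    have hp1 : κ.dual.isPositive = true := by simp [dual_pos hk, hp]
    rw [List.map_append] at hr
    cases ih with
    | daiD h _ => exact absurd h ht
    | daiR h hv => exact absurd (pos_unique hR hp1 rfl hr hv) (dual_ne hk)
    | stepD h => exact absurd h ht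
    | @stepR _ κ' _ hp' hr' _ hc' =>
      have hp2 : κ'.dual.isPositive = true := by simp [dual_pos (neg_ne_dai hp'), hp']
      rw [List.map_append] at hr'
      rwa [dual_inj (pos_unique hR hp1 hp2 hr hr')]

theorem Reach.sub {β β' : Base} {D F R : Set (List Action)} {dpos : Prop}
    (hD : IsDesign β D) (hF : IsDesign β F) (hR : IsDesign β' R) (hFD : F ⊆ D)
    (hc : Conv F R dpos []) {s : List Action} (h : Reach D R dpos s) :
    Reach F R dpos s := by
  induction h with
  | nil => exact Reach.nil
  | @stepD s κ h0 ht hp hk hd hr ih =>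
    cases Conv.reach hF hR hc ih with
    | daiD _ hv => exact absurd (pos_unique hD hp rfl hd (hFD hv)) hk
    | daiR h _ => exact absurd ht h
    | stepD _ hp' hk' hd' _ hc' =>
      rw [← pos_unique hD hp hp' hd (hFD hd')] at hd'
      exact Reach.stepD ih ht hp hk hd' hr
    | stepR h => exact absurd ht h
  | @stepR s κ h0 ht hp hr hd ih =>
    have hk := neg_ne_dai hp
    have hp1 : κ.dual.isPositive = true := by simp [dual_pos hk, hp]
    have hr0 := hr
    rw [List.map_append] at hr
    cases Conv.reach hF hR hc ih with
    | daiD h _ => exact absurd h ht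
    | daiR h hv => exact absurd (pos_unique hR hp1 rfl hr hv) (dual_ne hk)
    | stepD h => exact absurd h ht
    | @stepR _ κ' _ hp' hr' hd' hc' =>
      have hp2 : κ'.dual.isPositive = true := by simp [dual_pos (neg_ne_dai hp'), hp']
      rw [List.map_append] at hr'
      rw [← dual_inj (pos_unique hR hp1 hp2 hr hr')] at hd'
      exact Reach.stepR ih ht hp hr0 hd'

/-- Visited part of a design. -/
def Vis (dpos : Prop) (S : Set (Set (List Action))) (D : Set (List Action)) :
    Set (List Action) :=
  {v | ∃ E ∈ S, ∃ s, Reach D E dpos s ∧ ((s ≠ [] ∧ v = view s) ∨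
    (TurnD dpos s ∧ v = view (s ++ [Action.daimon]) ∧ v ∈ D))}

theorem Vis_sub {dpos : Prop} {S : Set (Set (List Action))} {D : Set (List Action)} :
    Vis dpos S D ⊆ D := by
  rintro v ⟨E, _, s, h, ⟨hs, rfl⟩ | ⟨_, _, h⟩⟩
  · exact h.memD hs
  · exact h

theorem Vis_design {β β' : Base} {dpos : Prop} {S : Set (Set (List Action))}
    {D : Set (List Action)} (hD : IsDesign β D) (hS : ∀ E ∈ S, IsDesign β' E)
    (hc : ∀ E ∈ S, Conv D E dpos []) (hne : β.isPositive → dpos ∧ S.Nonempty) :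
    IsDesign β (Vis dpos S D) where
  chron c h := hD.chron c (Vis_sub h)
  coherent c h d h' := hD.coherent c (Vis_sub h) d (Vis_sub h')
  prefixClosed := by
    rintro c ⟨E, hE, s, h, ⟨hs, rfl⟩ | ⟨ht, rfl, hm⟩⟩ d hd hd0
    · obtain ⟨t, ht, rfl⟩ := view_prefix _ s d le_rfl hd
      have ht0 : t ≠ [] := by rintro rfl; exact hd0 view_nil
      exact ⟨E, hE, t, h.pre t ht, Or.inl ⟨ht0, rfl⟩⟩
    · rw [view_pos _ rfl, List.prefix_concat_iff, ← view_pos _ rfl] at hd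
      rcases hd with rfl | hd
      · exact ⟨E, hE, s, h, Or.inr ⟨ht, rfl, hm⟩⟩
      · obtain ⟨t, ht, rfl⟩ := view_prefix _ s d le_rfl hd
        have ht0 : t ≠ [] := by rintro rfl; exact hd0 view_nil
        exact ⟨E, hE, t, h.pre t ht, Or.inl ⟨ht0, rfl⟩⟩
  maxPos := by
    rintro c ⟨E, hE, s, h, ⟨hs, rfl⟩ | ⟨ht, rfl, hm⟩⟩ hmax
    · obtain ⟨t, a, rfl⟩ := nil_or_snoc s |>.resolve_left hs
      by_cases ha : a.isPositive = true
      · exact ⟨a, by simp [view_pos _ ha], ha⟩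
      · exfalso
        have hcv := Conv.reach hD (hS E hE) (hc E hE) h
        have htt : TurnD dpos (t ++ [a]) := by simpa [TurnD] using ha
        cases hcv with
        | daiD _ hv =>
          apply hmax Action.daimon
          rw [← view_pos _ rfl]
          exact ⟨E, hE, _, h, Or.inr ⟨htt, rfl, hv⟩⟩
        | daiR h' => exact h' htt
        | @stepD _ κ _ hp hk hd hr _ =>
          apply hmax κ
          rw [← view_pos _ hp]
          exact ⟨E, hE, _, Reach.stepD h htt hp hk hd hr, Or.inl ⟨by simp, rfl⟩⟩
        | stepR h' => exact h' htt
    · exact ⟨Action.daimon, by rw [view_pos _ rfl]; simp, rfl⟩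
  posNonempty := by
    intro hβ
    obtain ⟨hd, E, hE⟩ := hne hβ
    have htt : TurnD dpos [] := by simpa [TurnD] using hd
    cases hc E hE with
    | daiD _ hv => exact ⟨_, E, hE, _, Reach.nil, Or.inr ⟨htt, rfl, hv⟩⟩
    | daiR h' => exact absurd htt h'
    | @stepD _ κ _ hp hk hd hr _ =>
      exact ⟨_, E, hE, _, Reach.stepD Reach.nil htt hp hk hd hr, Or.inl ⟨by simp, rfl⟩⟩
    | stepR h' => exact absurd htt h'

theorem Vis_conv {dpos : Prop} {S : Set (Set (List Action))}
    {D E : Set (List Action)} (hE : E ∈ S) {s : List Action} (hc : Conv D E dpos s)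
    (h : Reach D E dpos s) : Conv (Vis dpos S D) E dpos s := by
  induction hc with
  | daiD ht hv => exact Conv.daiD ht ⟨E, hE, _, h, Or.inr ⟨ht, rfl, hv⟩⟩
  | daiR ht hv => exact Conv.daiR ht hv
  | stepD ht hp hk hd hr _ ih =>
    have h' := Reach.stepD h ht hp hk hd hr
    exact Conv.stepD ht hp hk ⟨E, hE, _, h', Or.inl ⟨by simp, rfl⟩⟩ hr (ih h')
  | stepR ht hp hr hd _ ih =>
    have h' := Reach.stepR h ht hp hr hd
    exact Conv.stepR ht hp hr ⟨E, hE, _, h', Or.inl ⟨by simp, rfl⟩⟩ (ih h')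

theorem Vis_min {β β' : Base} {dpos : Prop} {S : Set (Set (List Action))}
    {D F : Set (List Action)} (hD : IsDesign β D) (hF : IsDesign β F)
    (hS : ∀ E ∈ S, IsDesign β' E) (hFD : F ⊆ D)
    (hc : ∀ E ∈ S, Conv F E dpos []) : Vis dpos S D ⊆ F := by
  rintro v ⟨E, hE, s, h, ⟨hs, rfl⟩ | ⟨ht, rfl, hm⟩⟩
  · exact (h.sub hD hF (hS E hE) hFD (hc E hE)).memD hs
  · have h' := h.sub hD hF (hS E hE) hFD (hc E hE)
    cases Conv.reach hF (hS E hE) (hc E hE) h' with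
    | daiD _ hv => exact hv
    | daiR h _ => exact absurd ht h
    | stepD _ hp' hk' hd' _ hc' =>
      exact absurd (pos_unique hD hp' rfl (hFD hd') hm) hk'
    | stepR h => exact absurd ht h

theorem mem_orth {ξ : Address} {pos : Bool} {S : Set (Set (List Action))}
    {E : Set (List Action)} : E ∈ orthSet ξ pos S ↔
      IsDesign (simpleBase ξ !pos) E ∧ ∀ D ∈ S, Conv E D ((!pos) = true) [] := by
  have key : ∀ (X Y : Set (List Action)), Conv X Y True [] → Conv Y X False [] := by
    intro X Y h
    have := h.dual (by simp)
    simpa using this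
  have key' : ∀ (X Y : Set (List Action)), Conv X Y False [] → Conv Y X True [] := by
    intro X Y h
    have := h.dual (by simp)
    simpa using this
  cases pos
  · simp [orthSet]
  · simp only [orthSet, Set.mem_setOf_eq, if_true, Bool.not_true, Bool.false_eq_true]
    exact and_congr_right fun _ => forall₂_congr fun D _ => ⟨key _ _, key' _ _⟩

theorem initial_iff {ξ : Address} {b : Bool} {a : Action} :
    Initial (simpleBase ξ b) a ↔ ∃ I, a = Action.proper b ξ I := by
  cases b
  · simp only [Initial, simpleBase]
    constructor
    · rintro ⟨pol, ζ, I, rfl, σ, hσ, h⟩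
      simp at hσ
      subst hσ
      simp at h
      obtain ⟨rfl, rfl⟩ := h
      exact ⟨I, rfl⟩
    · rintro ⟨I, rfl⟩
      exact ⟨false, ξ, I, rfl, _, List.mem_singleton.2 rfl, Or.inr ⟨rfl, rfl⟩⟩
  · simp only [Initial, simpleBase]
    constructor
    · rintro ⟨pol, ζ, I, rfl, σ, hσ, h⟩
      simp at hσ
      subst hσ
      simp at h
      obtain ⟨rfl, rfl⟩ := h
      exact ⟨I, rfl⟩
    · rintro ⟨I, rfl⟩
      exact ⟨true, ξ, I, rfl, _, List.mem_singleton.2 rfl, Or.inl ⟨rfl, by simp⟩⟩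

theorem base_pos {ξ : Address} {b : Bool} : (simpleBase ξ b).isPositive ↔ b = true := by
  cases b <;> simp [simpleBase, Base.isPositive]

/-- Polarity determined by the parity of the focus. -/
def PolOK (ξ : Address) (b : Bool) (a : Action) : Prop :=
  ∃ p ζ I, a = Action.proper p ζ I ∧ ∃ n, ζ.length = ξ.length + n ∧
    p = xor b (n % 2 == 1)

theorem PolOK.dual {ξ : Address} {b : Bool} {a : Action} (h : PolOK ξ b a) :
    PolOK ξ (!b) a.dual := by
  obtain ⟨p, ζ, I, rfl, n, hn, rfl⟩ := h
  exact ⟨_, ζ, I, rfl, n, hn, by simp⟩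

theorem polOK_step {ξ : Address} {b : Bool} {D : Set (List Action)}
    (hD : IsDesign (simpleBase ξ b) D) {s : List Action} {κ : Action}
    (hs : ∀ a ∈ s, PolOK ξ b a) (hk : κ.isPositive = false)
    (hv : view (s ++ [κ]) ∈ D) : PolOK ξ b κ := by
  obtain ⟨s', hs', e⟩ := view_concat s κ
  rw [e] at hv
  have hc := hD.chron _ hv
  have hI : Initial (simpleBase ξ b) κ → PolOK ξ b κ := by
    intro h
    obtain ⟨I, rfl⟩ := initial_iff.1 h
    exact ⟨b, ξ, I, rfl, 0, by simp, by simp⟩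
  rcases nil_or_snoc (view s') with h0 | ⟨t, a, h0⟩
  · rw [h0] at hc
    rcases hc.1.justified [] κ List.prefix_rfl (neg_ne_dai hk) with h | ⟨_, h, _⟩
    · exact hI h
    · simp at h
  · have ha : a ∈ s := hs'.subset (mem_of_view (by rw [h0]; simp))
    rw [h0] at hc
    simp only [List.append_assoc, List.cons_append,
      List.nil_append] at hc
    rcases hc.2.2 t a κ List.prefix_rfl hk with h | h
    · exact hI h
    · have hp : a.isPositive = true := by
        have := hc.1.alternating
        have := (List.isChain_append.1 this).2.1
        simp [hk] at this
        exact this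
      obtain ⟨p, ζ, I, rfl, n, hn, hpn⟩ := hs a ha
      simp only [Action.isPositive] at hp
      subst hp
      cases κ with
      | daimon => simp [Action.isPositive] at hk
      | proper q ζ' J =>
        simp only [Action.isPositive] at hk
        subst hk
        simp only [Action.justifies, Action.justifiesB, decide_eq_true_eq] at h
        obtain ⟨i, _, rfl⟩ := h
        refine ⟨_, _, _, rfl, n + 1, by simp [hn]; omega, ?_⟩
        rcases Nat.mod_two_eq_zero_or_one n with h | h
        · have h' : (n + 1) % 2 = 1 := by omega
          rw [h] at hpn
          rw [h']
          revert hpn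
          cases b <;> simp
        · have h' : (n + 1) % 2 = 0 := by omega
          rw [h] at hpn
          rw [h']
          revert hpn
          cases b <;> simp

theorem Reach.polOK {ξ : Address} {b : Bool} {D R : Set (List Action)} {dpos : Prop}
    (hD : IsDesign (simpleBase ξ b) D) (hR : IsDesign (simpleBase ξ !b) R)
    {s : List Action} (h : Reach D R dpos s) : ∀ a ∈ s, PolOK ξ b a := by
  induction h with
  | nil => simp
  | @stepD s κ h0 ht hp hk hd hr ih =>
    intro a ha
    rcases List.mem_append.1 ha with ha | ha
    · exact ih a ha
    · rw [List.mem_singleton.1 ha]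
      rw [List.map_append] at hr
      have := polOK_step hR (s := s.map Action.dual) (κ := κ.dual) (by
        intro a ha
        obtain ⟨a', ha', rfl⟩ := List.mem_map.1 ha
        exact (ih a' ha').dual) (by simp [dual_pos hk, hp]) hr
      have := this.dual
      rwa [dual_dual, Bool.not_not] at this
  | @stepR s κ h0 ht hp hr hd ih =>
    intro a ha
    rcases List.mem_append.1 ha with ha | ha
    · exact ih a ha
    · rw [List.mem_singleton.1 ha]
      exact polOK_step hD ih hp hd

def Lin (s : List Action) : Prop := (s.filterMap Action.focus?).Nodup

theorem Lin.append_ne {u v : List Action} (h : Lin (u ++ v)) {x y : Action}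
    (hx : x ∈ u) (hy : y ∈ v) {f : Address} (h1 : x.focus? = some f)
    (h2 : y.focus? = some f) : False := by
  unfold Lin at h
  rw [List.filterMap_append, List.nodup_append] at h
  exact h.2.2 f (List.mem_filterMap.2 ⟨x, hx, h1⟩) f (List.mem_filterMap.2 ⟨y, hy, h2⟩) rfl

theorem Lin.eq {s : List Action} (h : Lin s) {x y : Action}
    (hx : x ∈ s) (hy : y ∈ s) {f : Address} (h1 : x.focus? = some f)
    (h2 : y.focus? = some f) : x = y := by
  obtain ⟨u, v, rfl⟩ := List.append_of_mem hx
  rcases List.mem_append.1 hy with hy | hy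
  · exact (h.append_ne hy (List.mem_cons_self) h2 h1).elim
  · rcases List.mem_cons.1 hy with hy | hy
    · exact hy.symm
    · rw [← List.singleton_append, ← List.append_assoc] at h
      exact (h.append_ne (u := u ++ [x]) (by simp) hy h1 h2).elim

theorem diverge : ∀ (l m : List Action), l <+: m ∨ m <+: l ∨
    ∃ u x y, x ≠ y ∧ u ++ [x] <+: l ∧ u ++ [y] <+: m := by
  intro l
  induction l with
  | nil => intro m; simp
  | cons a l ih =>
    intro m
    cases m with
    | nil => simp
    | cons b m =>
      by_cases hab : a = b
      · subst hab
        rcases ih m with h | h | ⟨u, x, y, hne, h1, h2⟩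
        · left; simpa using h
        · right; left; simpa using h
        · right; right
          exact ⟨a :: u, x, y, hne, by simpa using h1, by simpa using h2⟩
      · right; right
        exact ⟨[], a, b, hab, by simp, by simp⟩

theorem lin_step {β : Base} {D : Set (List Action)} (hD : IsDesign β D)
    {s : List Action} {κ : Action} (hl : Lin s) (hs : ∀ a ∈ s, a ≠ Action.daimon)
    (hk : κ.isPositive = true) (hpre : ∀ t, t <+: s ++ [κ] → t ≠ [] → view t ∈ D)
    (hpol : ∀ a ∈ s, ∀ f, a.focus? = some f → κ.focus? = some f → a.isPositive = true) :
    Lin (s ++ [κ]) := by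
  have main : ∀ f, κ.focus? = some f → ∀ a ∈ s, a.focus? = some f → False := by
    intro f hf a ha haf
    have hap := hpol a ha f haf hf
    obtain ⟨w, z, rfl⟩ := List.append_of_mem ha
    have h1 : view w ++ [a] ∈ D := by
      rw [← view_pos _ hap]
      exact hpre _ (by simp) (by simp)
    have h2 : view (w ++ a :: z) ++ [κ] ∈ D := by
      rw [← view_pos _ hk]
      exact hpre _ List.prefix_rfl (by simp)
    have l1 : Lin (view w ++ [a]) := (hD.chron _ h1).1.linearity
    have l2 : Lin (view (w ++ a :: z) ++ [κ]) := (hD.chron _ h2).1.linearity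
    have heq : view w = view (w ++ a :: z) → False := by
      intro e
      have hne : w ++ a :: z ≠ [] := by simp
      have hw : w ≠ [] := by
        rintro rfl
        rw [view_nil] at e
        exact view_ne hne e.symm
      obtain ⟨w0, x, rfl⟩ := nil_or_snoc w |>.resolve_left hw
      obtain ⟨z0, y, hz⟩ := nil_or_snoc (a :: z) |>.resolve_left (by simp)
      rw [hz] at e hl hs
      rw [← List.append_assoc] at e
      obtain ⟨_, _, e1⟩ := view_concat w0 x
      obtain ⟨_, _, e2⟩ := view_concat (w0 ++ [x] ++ z0) y
      rw [e1, e2] at e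
      have hxy : x = y := by
        have := congrArg List.getLast? e
        simpa using this
      subst hxy
      have hx : x ≠ Action.daimon := hs x (by simp)
      cases x with
      | daimon => exact hx rfl
      | proper p ζ I =>
        exact hl.append_ne (x := Action.proper p ζ I) (y := Action.proper p ζ I)
          (f := ζ) (by simp) (by simp) rfl rfl
    rcases diverge (view w ++ [a]) (view (w ++ a :: z) ++ [κ]) with h | h | ⟨u, x, y, hne, hx, hy⟩
    · rcases List.prefix_concat_iff.1 h with h | h
      · exact heq (List.append_inj_left' h rfl)
      · exact l2.append_ne (h.subset (by simp : a ∈ _)) (List.mem_singleton.2 rfl) haf hf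
    · rcases List.prefix_concat_iff.1 h with h | h
      · exact heq (List.append_inj_left' h rfl).symm
      · exact l1.append_ne (h.subset (by simp : κ ∈ _)) (List.mem_singleton.2 rfl) hf haf
    · rcases (hD.coherent _ h1 _ h2).1 u x y hx hy with h | ⟨hxn, hyn⟩
      · exact hne h
      · have hx' : u ++ [x] <+: view w := by
          rcases List.prefix_concat_iff.1 hx with h | h
          · have := (List.append_inj' h rfl).2
            simp at this
            subst this
            simp [hap] at hxn
          · exact h
        have hy' : u ++ [y] <+: view (w ++ a :: z) := by
          rcases List.prefix_concat_iff.1 hy with h | h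
          · have := (List.append_inj' h rfl).2
            simp at this
            subst this
            simp [hk] at hyn
          · exact h
        have hxm : x ∈ w ++ a :: z :=
          List.mem_append_left _ (mem_of_view (hx'.subset (by simp)))
        have hym : y ∈ w ++ a :: z := mem_of_view (hy'.subset (by simp))
        cases x with
        | daimon => simp [Action.isPositive] at hxn
        | proper p1 ξ1 I1 =>
        cases y with
        | daimon => simp [Action.isPositive] at hyn
        | proper p2 ξ2 I2 =>
        simp only [Action.isPositive] at hxn hyn
        subst hxn hyn
        by_cases hξ : ξ1 = ξ2
        · subst hξ
          exact hne (hl.eq hxm hym (f := ξ1) rfl rfl)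
        · obtain ⟨w1, e1⟩ := hx'
          obtain ⟨w2, e2⟩ := hy'
          refine (hD.coherent _ h1 _ h2).2 u ξ1 I1 w1 a ξ2 I2 w2 κ ?_ ?_ hξ f haf hf
          · rw [← e1]; simp
          · rw [← e2]; simp
  unfold Lin at *
  rw [List.filterMap_append, List.nodup_append]
  refine ⟨hl, ?_, ?_⟩
  · cases κ with
    | daimon => exact List.nodup_nil
    | proper p ζ I => exact List.nodup_singleton ζ
  · intro f hf g hg hfg
    subst hfg
    obtain ⟨a, ha, haf⟩ := List.mem_filterMap.1 hf
    obtain ⟨k, hk', hkf⟩ := List.mem_filterMap.1 hg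
    rw [List.mem_singleton.1 hk'] at hkf
    exact main f hkf a ha haf

theorem lin_dual {s : List Action} : Lin (s.map Action.dual) ↔ Lin s := by
  unfold Lin
  rw [List.filterMap_map]
  have : (Action.focus? ∘ Action.dual) = Action.focus? := by
    funext a; exact dual_focus a
  rw [this]

theorem PolOK.same {ξ : Address} {b : Bool} {x y : Action} (hx : PolOK ξ b x)
    (hy : PolOK ξ b y) {f : Address} (h1 : x.focus? = some f) (h2 : y.focus? = some f) :
    x.isPositive = y.isPositive := by
  obtain ⟨p, ζ, I, rfl, n, hn, rfl⟩ := hx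
  obtain ⟨q, ζ', J, rfl, m, hm, rfl⟩ := hy
  simp only [Action.focus?, Option.some.injEq] at h1 h2
  subst h1 h2
  have : n = m := by omega
  subst this
  rfl

theorem Reach.lin {ξ : Address} {b : Bool} {D R : Set (List Action)} {dpos : Prop}
    (hD : IsDesign (simpleBase ξ b) D) (hR : IsDesign (simpleBase ξ !b) R)
    {s : List Action} (h : Reach D R dpos s) : Lin s := by
  induction h with
  | nil => simp [Lin]
  | @stepD s κ h0 ht hp hk hd hr ih =>
    have h1 := Reach.stepD h0 ht hp hk hd hr
    have hpol := h1.polOK hD hR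
    refine lin_step hD ih h0.ne hp (fun t ht h => (h1.pre t ht).memD h) ?_
    intro a ha f h2 h3
    rw [← hp]
    exact (hpol a (by simp [ha])).same (hpol κ (by simp)) h2 h3
  | @stepR s κ h0 ht hp hr hd ih =>
    have hk := neg_ne_dai hp
    have h1 := Reach.stepR h0 ht hp hr hd
    have hpol := h1.polOK hD hR
    rw [← lin_dual, List.map_append]
    have h1' := h1.dual
    rw [List.map_append] at h1'
    refine lin_step hR (lin_dual.2 ih) h0.dual.ne (by simp [dual_pos hk, hp])
      (fun t ht h => (h1'.pre t ht).memD h) ?_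
    intro a ha f h2 h3
    obtain ⟨a, ha', rfl⟩ := List.mem_map.1 ha
    rw [dual_focus] at h2 h3
    rw [dual_pos (h0.ne a ha'), (hpol a (by simp [ha'])).same (hpol κ (by simp)) h2 h3, hp]
    rfl

theorem JustChain.mono {β : Base} {p q s : List Action} (h : JustChain β p s)
    (hs : ∀ a ∈ p, a ≠ Action.daimon → a ∈ q) : JustChain β q s := by
  induction h with
  | init hk hi =>
    refine JustChain.init (hs _ hk ?_) hi
    obtain ⟨_, _, _, rfl, _⟩ := hi
    simp
  | cons _ hk hj ih =>
    refine JustChain.cons ih (hs _ hk ?_) hj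
    rintro rfl
    simp [Action.justifies, Action.justifiesB] at hj

theorem JustChain.dual {ξ : Address} {b : Bool} {p s : List Action}
    (h : JustChain (simpleBase ξ b) p s) :
    JustChain (simpleBase ξ !b) (p.map Action.dual) (s.map Action.dual) := by
  induction h with
  | init hk hi =>
    refine JustChain.init (List.mem_map_of_mem hk) ?_
    obtain ⟨I, rfl⟩ := initial_iff.1 hi
    exact initial_iff.2 ⟨I, rfl⟩
  | cons _ hk hj ih =>
    rw [List.map_append] at ih ⊢
    exact JustChain.cons ih (List.mem_map_of_mem hk) (justifies_dual hj)

theorem JustChain.last {ξ : Address} {b : Bool} {p s : List Action}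
    (h : JustChain (simpleBase ξ b) p s) :
    ∃ t κ, s = t ++ [κ] ∧ κ ∈ p ∧ ∃ f, κ.focus? = some f ∧ ξ.length ≤ f.length := by
  induction h with
  | @init κ hk hi =>
    obtain ⟨I, rfl⟩ := initial_iff.1 hi
    exact ⟨[], _, rfl, hk, ξ, rfl, le_rfl⟩
  | @cons s κ κ' _ hk hj ih =>
    obtain ⟨t, x, e, _, f, hf, hl⟩ := ih
    have e := (List.append_inj' e rfl).2
    simp at e
    subst e
    refine ⟨s ++ [κ], κ', by simp, hk, ?_⟩
    cases κ <;> cases κ' <;> simp_all [Action.justifies, Action.justifiesB, Action.focus?]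
    obtain ⟨i, _, rfl⟩ := hj
    simp; omega

theorem chain_in_chronicle {ξ : Address} {b : Bool} {r v σ : List Action}
    (hr : Lin r) (hv : IsPath (simpleBase ξ b) v) (hsub : ∀ a ∈ v, a ∈ r)
    (h : JustChain (simpleBase ξ b) r σ) :
    (∀ t κ, σ = t ++ [κ] → κ ∈ v) → JustChain (simpleBase ξ b) v σ := by
  induction h with
  | @init κ hk hi => intro h; exact JustChain.init (h [] κ rfl) hi
  | @cons s κ κ' hc hk hj ih =>
    intro h
    have hk' := h (s ++ [κ]) κ' (by simp)
    refine JustChain.cons (ih ?_) hk' hj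
    intro t x e
    have e := (List.append_inj' e rfl).2
    simp at e
    subst e
    obtain ⟨_, x, e, hκr, f, hf, hl⟩ := hc.last
    have e := (List.append_inj' e rfl).2
    simp at e
    subst e
    obtain ⟨u, z, rfl⟩ := List.append_of_mem hk'
    have hd : κ' ≠ Action.daimon := by
      rintro rfl; simp [Action.justifies, Action.justifiesB] at hj
    rcases hv.justified u κ' (by simp) hd with hi | ⟨y, hy, hyj⟩
    · exfalso
      obtain ⟨I, rfl⟩ := initial_iff.1 hi
      cases κ with
      | daimon => simp [Action.focus?] at hf
      | proper p ζ J =>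
        simp only [Action.justifies, Action.justifiesB, decide_eq_true_eq] at hj
        obtain ⟨i, _, rfl⟩ := hj
        simp only [Action.focus?, Option.some.injEq] at hf
        subst hf
        simp at hl
    · have hyr := hsub y (by simp [hy])
      have : y.focus? = κ.focus? := by
        cases y <;> cases κ <;> cases κ' <;>
          simp_all [Action.justifies, Action.justifiesB, Action.focus?]
        obtain ⟨i, _, rfl⟩ := hj
        obtain ⟨j, _, e⟩ := hyj
        exact (List.append_inj' e rfl).1.symm
      rw [hf] at this
      have := hr.eq hyr hκr this hf
      subst this
      simp [hy]

/-- The negative daimon design. -/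
def NegDai (ξ : Address) : Set (List Action) :=
  {c | ∃ I, c = [Action.proper false ξ I] ∨ c = [Action.proper false ξ I, Action.daimon]}

theorem prefix_two {w : List Action} {a x y : Action} (h : w ++ [a] <+: [x, y]) :
    (w = [] ∧ a = x) ∨ (w = [x] ∧ a = y) := by
  obtain ⟨t, ht⟩ := h
  rcases w with _ | ⟨b, _ | ⟨c, w⟩⟩
  · simp at ht; exact Or.inl ⟨rfl, ht.1⟩
  · simp at ht; exact Or.inr ⟨by rw [ht.1], ht.2.1⟩
  · simp at ht

theorem negDai_path (ξ : Address) (I : Finset ℕ) :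
    IsPath (simpleBase ξ false) [Action.proper false ξ I, Action.daimon] where
  alternating := List.isChain_pair.2 (by simp [Action.isPositive])
  justified := by
    intro w a h ha
    rcases prefix_two h with ⟨rfl, rfl⟩ | ⟨rfl, rfl⟩
    · exact Or.inl (initial_iff.2 ⟨I, rfl⟩)
    · exact absurd rfl ha
  negJump := by
    intro w a b h ha hb hj
    rcases prefix_two h with ⟨rfl, rfl⟩ | ⟨rfl, rfl⟩
    · simp at hb
    · cases b <;> simp [Action.justifies, Action.justifiesB] at hj
  posJump := by
    intro w a h ha hd
    rcases prefix_two h with ⟨rfl, rfl⟩ | ⟨rfl, rfl⟩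
    · simp [Action.isPositive] at ha
    · exact absurd rfl hd
  linearity := List.nodup_singleton ξ
  daimonLast := by
    intro w h
    rcases prefix_two h with ⟨rfl, h⟩ | ⟨rfl, _⟩
    · simp at h
    · rfl
  daimonFirst := by simp
  totality := by intro h; simp [base_pos] at h

theorem negDai_path1 (ξ : Address) (I : Finset ℕ) :
    IsPath (simpleBase ξ false) [Action.proper false ξ I] where
  alternating := List.isChain_singleton _
  justified := by
    intro w a h ha
    exact (negDai_path ξ I).justified w a (h.trans (by simp)) ha
  negJump := by
    intro w a b h ha hb hj
    exact (negDai_path ξ I).negJump w a b (h.trans (by simp)) ha hb hj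
  posJump := by
    intro w a h ha hd
    exact (negDai_path ξ I).posJump w a (h.trans (by simp)) ha hd
  linearity := List.nodup_singleton ξ
  daimonLast := by
    intro w h
    rcases prefix_two (h.trans (by simp : _ <+: [Action.proper false ξ I, Action.daimon]))
      with ⟨rfl, h⟩ | ⟨rfl, _⟩
    · simp at h
    · have := h.length_le
      simp at this
  daimonFirst := by simp
  totality := by intro h; simp [base_pos] at h

theorem negDai_mem_prefix {ξ : Address} {c : List Action} (h : c ∈ NegDai ξ) :
    ∃ I, c <+: [Action.proper false ξ I, Action.daimon] := by
  obtain ⟨I, rfl | rfl⟩ := h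
  · exact ⟨I, by simp⟩
  · exact ⟨I, List.prefix_rfl⟩

theorem negDai_design (ξ : Address) : IsDesign (simpleBase ξ false) (NegDai ξ) where
  chron := by
    intro c hc
    refine ⟨?_, ?_, ?_⟩
    · obtain ⟨I, rfl | rfl⟩ := hc
      · exact negDai_path1 ξ I
      · exact negDai_path ξ I
    · obtain ⟨I, rfl | rfl⟩ := hc <;> simp
    · intro w a b h hb
      obtain ⟨I, hI⟩ := negDai_mem_prefix hc
      have h' := h.trans hI
      rw [show w ++ [a, b] = (w ++ [a]) ++ [b] by simp] at h'
      rcases prefix_two h' with ⟨h, _⟩ | ⟨_, rfl⟩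
      · simp at h
      · simp [Action.isPositive] at hb
  prefixClosed := by
    intro c hc d hd hne
    obtain ⟨I, hI⟩ := negDai_mem_prefix hc
    obtain ⟨w, a, rfl⟩ := (nil_or_snoc d).resolve_left hne
    rcases prefix_two (hd.trans hI) with ⟨rfl, rfl⟩ | ⟨rfl, rfl⟩
    · exact ⟨I, Or.inl rfl⟩
    · exact ⟨I, Or.inr rfl⟩
  coherent := by
    intro c hc d hd
    obtain ⟨I, hI⟩ := negDai_mem_prefix hc
    obtain ⟨J, hJ⟩ := negDai_mem_prefix hd
    refine ⟨?_, ?_⟩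
    · intro w a b ha hb
      rcases prefix_two (ha.trans hI) with ⟨rfl, rfl⟩ | ⟨rfl, rfl⟩
      · rcases prefix_two (hb.trans hJ) with ⟨_, rfl⟩ | ⟨h, _⟩
        · exact Or.inr ⟨rfl, rfl⟩
        · simp at h
      · rcases prefix_two (hb.trans hJ) with ⟨h, _⟩ | ⟨_, rfl⟩
        · simp at h
        · exact Or.inl rfl
    · intro w ξ₁ I₁ w₁ σ₁ ξ₂ I₂ w₂ σ₂ h1 h2 hne f hf
      rcases prefix_two (h1.trans hI) with ⟨h, _⟩ | ⟨_, rfl⟩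
      · simp at h
      · simp [Action.focus?] at hf
  maxPos := by
    rintro c ⟨I, rfl | rfl⟩ h
    · exact absurd ⟨I, Or.inr rfl⟩ (h Action.daimon)
    · exact ⟨Action.daimon, by simp, rfl⟩
  posNonempty := by intro h; simp [base_pos] at h

theorem negDai_orth {ξ : Address} {S : Set (Set (List Action))}
    (hS : ∀ D ∈ S, IsDesign (simpleBase ξ true) D) : NegDai ξ ∈ orthSet ξ true S := by
  refine ⟨negDai_design ξ, ?_⟩
  intro D hD
  simp only [if_true]
  have hd := hS D hD
  obtain ⟨c, hc⟩ := hd.posNonempty (base_pos.2 rfl)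
  obtain ⟨a, t, rfl, h⟩ := (hd.chron c hc).1.totality (base_pos.2 rfl)
  have ha : [a] ∈ D := hd.prefixClosed _ hc _ (by simp) (by simp)
  rcases h with rfl | ⟨hp, hi⟩
  · refine Conv.daiD (by simp [TurnD]) ?_
    rw [view_pos _ rfl, view_nil]; exact ha
  · obtain ⟨I, rfl⟩ := initial_iff.1 hi
    have hv : view [Action.proper false ξ I] = [Action.proper false ξ I] := by
      simp [view, viewRev, viewRevAux, Action.isPositive]
    refine Conv.stepD (κ := Action.proper true ξ I) (by simp [TurnD]) rfl (by simp) ?_ ?_ ?_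
    · rw [view_pos _ rfl, view_nil]; exact ha
    · exact ⟨I, Or.inl hv⟩
    · refine Conv.daiR (by simp [TurnD, Action.isPositive]) ?_
      rw [view_pos _ rfl]
      exact ⟨I, Or.inr (by simp [Action.dual, hv])⟩

theorem vis_material {ξ : Address} {b : Bool} (C : Behaviour ξ b)
    {S : Set (Set (List Action))}
    (hC : ∀ E, E ∈ C.designs ↔
      IsDesign (simpleBase ξ b) E ∧ ∀ D ∈ S, Conv E D (b = true) [])
    (hS : ∀ E ∈ S, IsDesign (simpleBase ξ !b) E) (hne : b = true → S.Nonempty)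
    {D : Set (List Action)} (hD : D ∈ C.designs) :
    Material C (Vis (b = true) S D) := by
  have h := (hC D).1 hD
  refine ⟨(hC _).2 ⟨Vis_design h.1 hS h.2 ?_, fun E hE => Vis_conv hE (h.2 E hE) Reach.nil⟩, ?_⟩
  · intro hb
    exact ⟨base_pos.1 hb, hne (base_pos.1 hb)⟩
  · intro F hF hFD
    have hF' := (hC F).1 hF
    exact hFD.antisymm (Vis_min h.1 hF'.1 hS (hFD.trans Vis_sub) hF'.2)

theorem triv_dual {ξ : Address} {b : Bool} (A : Behaviour ξ b) (B : Behaviour ξ (!b))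
    (hB : B.designs = orthSet ξ b A.designs) {s : List Action}
    (h : TrivialChronicle B s) : TrivialChronicle A (s.map Action.dual) := by
  have hBm : ∀ E, E ∈ B.designs ↔
      IsDesign (simpleBase ξ !b) E ∧ ∀ D ∈ A.designs, Conv E D ((!b) = true) [] := by
    intro E; rw [hB]; exact mem_orth
  have hAB : A.designs = orthSet ξ (!b) B.designs := by
    rw [hB]; exact A.closed
  have hAm : ∀ E, E ∈ A.designs ↔
      IsDesign (simpleBase ξ b) E ∧ ∀ D ∈ B.designs, Conv E D (b = true) [] := by
    intro E
    have := @mem_orth ξ (!b) B.designs E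
    rw [← hAB, Bool.not_not] at this
    exact this
  have hAne : (!b) = true → A.designs.Nonempty := by
    intro hb
    have hb' : b = false := by simpa using hb
    subst hb'
    rw [hAB]
    exact ⟨_, negDai_orth B.isDesign⟩
  obtain ⟨D, hD, c, hc, hch⟩ := h
  have hDV : Vis ((!b) = true) A.designs D = D :=
    hD.2 _ (vis_material B hBm (by simpa using A.isDesign) hAne hD.1).1 Vis_sub
  rw [← hDV] at hc
  obtain ⟨E, hE, q, hq, hcq⟩ := hc
  have hDd := B.isDesign D hD.1
  have hEd := A.isDesign E hE
  have hch' : JustChain (simpleBase ξ !b) q s := by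
    refine hch.mono ?_
    intro a ha hne
    rcases hcq with ⟨_, rfl⟩ | ⟨_, rfl, _⟩
    · exact mem_of_view ha
    · rcases List.mem_append.1 (mem_of_view ha) with h | h
      · exact h
      · exact absurd (List.mem_singleton.1 h) hne
  have hlin : Lin (q.map Action.dual) :=
    lin_dual.2 (hq.lin hDd (by rw [Bool.not_not]; exact hEd))
  have hdual := hch'.dual
  rw [Bool.not_not] at hdual
  have hmat : Material A (Vis (b = true) B.designs E) :=
    vis_material A hAm B.isDesign (fun _ => ⟨D, hD.1⟩) hE
  have hq' := hq.dual
  have hbb : (¬ ((!b) = true)) = (b = true) := by cases b <;> simp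
  rw [hbb] at hq'
  obtain ⟨t, κ, e, hκ, _⟩ := hdual.last
  obtain ⟨u, z, hu⟩ := List.append_of_mem hκ
  have hpre : u ++ [κ] <+: q.map Action.dual := by rw [hu]; simp
  refine ⟨_, hmat, view (u ++ [κ]), ⟨D, hD.1, u ++ [κ], hq'.pre _ hpre, Or.inl ⟨by simp, rfl⟩⟩, ?_⟩
  have hvE : view (u ++ [κ]) ∈ E := (hq'.pre _ hpre).memD (by simp)
  refine chain_in_chronicle hlin (hEd.chron _ hvE).1
    (fun a ha => hpre.subset (mem_of_view ha)) hdual ?_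
  intro t' κ' e'
  rw [e] at e'
  have e' := (List.append_inj' e' rfl).2
  simp at e'
  subst e'
  obtain ⟨_, _, e⟩ := view_concat u κ
  rw [e]; simp

theorem dualSeq_dualSeq {β : Base} {p : List Action} (hp : IsPath β p) :
    dualSeq (dualSeq p) = p := by
  by_cases h : p.getLast? = some Action.daimon
  · obtain ⟨q, a, rfl⟩ := (nil_or_snoc p).resolve_left (by rintro rfl; simp at h)
    simp at h
    subst h
    have h1 : dualSeq (q ++ [Action.daimon]) = q.map Action.dual := by simp [dualSeq]
    have h2 : (q.map Action.dual).getLast? ≠ some Action.daimon := by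
      intro h
      obtain ⟨r, a, rfl⟩ := (nil_or_snoc q).resolve_left (by rintro rfl; simp at h)
      simp at h
      have ha : a = Action.daimon := by
        rw [← dual_dual a, h]; rfl
      subst ha
      have := hp.daimonLast r (by simp)
      simp at this
    rw [h1, dualSeq, if_neg h2, map_dual_dual]
  · have h1 : dualSeq p = p.map Action.dual ++ [Action.daimon] := by rw [dualSeq, if_neg h]
    rw [h1, dualSeq, if_pos (by simp), List.dropLast_concat, map_dual_dual]

theorem mem_dualSeq {p : List Action} {a : Action} (ha : a ≠ Action.daimon) :
    a.dual ∈ dualSeq p ↔ a ∈ p := by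
  have hinj : ∀ q : List Action, a.dual ∈ q.map Action.dual ↔ a ∈ q := by
    intro q
    refine ⟨fun h => ?_, List.mem_map_of_mem⟩
    obtain ⟨b, hb, e⟩ := List.mem_map.1 h
    rwa [← dual_inj e]
  by_cases h : p.getLast? = some Action.daimon
  · obtain ⟨q, x, rfl⟩ := (nil_or_snoc p).resolve_left (by rintro rfl; simp at h)
    simp at h
    subst h
    rw [dualSeq, if_pos (by simp), List.dropLast_concat, hinj]
    simp [ha]
  · rw [dualSeq, if_neg h, List.mem_append, hinj]
    simp [dual_ne ha]

/-- regularity is stable under orthogonality: if `A` is a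
regular behaviour then `A⊥` is regular. -/
theorem regular_orth (ξ : Address) (pos : Bool)
    (A : Behaviour ξ pos) (B : Behaviour ξ (!pos))
    (hB : B.designs = orthSet ξ pos A.designs)
    (hA : Regular A) :
    Regular B := by
  intro p hp
  obtain ⟨h1, h2, h3⟩ := hp
  rw [Bool.not_not] at h2
  have hdd := dualSeq_dualSeq h1
  have hreg : RegularPath A (dualSeq p) := by
    refine ⟨h2, by rwa [hdd], ?_⟩
    intro κ hκ hne
    have hκ' : κ.dual ∈ p := by
      rw [← dual_dual κ] at hκ
      exact (mem_dualSeq (dual_ne hne)).1 hκ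
    obtain ⟨s, hs, hl, ht⟩ := h3 κ.dual hκ' (dual_ne hne)
    refine ⟨s.map Action.dual, ?_, ?_, triv_dual A B hB ht⟩
    · have := hs.dual
      rw [Bool.not_not] at this
      refine this.mono ?_
      intro a ha hane
      obtain ⟨a, ha', rfl⟩ := List.mem_map.1 ha
      refine (mem_dualSeq ?_).2 ha'
      rintro rfl
      exact hane rfl
    · rw [List.getLast?_map, hl]
      simp [dual_dual]
  obtain ⟨D, hD, E, hE, hpD, hpE⟩ := hA _ hreg
  rw [hdd] at hpE
  refine ⟨E, by rw [hB]; exact hE, D, ?_, hpE, ?_⟩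
  · rw [hB]
    have := A.closed
    rw [biorth] at this
    rwa [← this]
  · rwa [Bool.not_not]

end Ludics
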